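/- arXiv:1002.2797 — 3 statements merged into one kernel-verified Lean document; each statement's English description precedes it below -/
import Mathlib

section
/- Let p be a prime, e ≥ 2 an integer, j the smallest positive integer such that e divides p^j + 1, and q = p^{2jγ} with γ ≥ 1; set f = (q−1)/e. Let m ≥ 1, let Q be a nonsingular quadratic form on V = F_q^{2m}, and let ε ∈ {1,−1} be such that ∑_{x∈V} ψ_1(αQ(x)) = ε q^m for every α ∈ F_q^× (ε = 1 when Q is hyperbolic, ε = −1 when Q is elliptic). Then for each i with 0 ≤ i ≤ e−1, the set D_{C_i} = {x ∈ V : Q(x) ∈ C_i} is a partial difference set in (V,+) with parameters (N², (N−ε)R, εN + R² − 3εR, R² − εR), where N = q^m and R = f q^{m−1}. -/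
open Finset

noncomputable section
open scoped Classical

/-- `D` is a `(v,k,λ,μ)` partial difference set in the finite abelian group `G`:
every nonzero element of `D` is a difference of elements of `D` in exactly `λ` ways,
and every nonzero element outside `D` in exactly `μ` ways. -/
def IsPDS {G : Type*} [AddCommGroup G] [Fintype G] (D : Finset G) (v k lam mu : ℤ) : Prop :=
  (Fintype.card G : ℤ) = v ∧ (D.card : ℤ) = k ∧
    ∀ g : G, g ≠ 0 →
      ((((D ×ˢ D).filter fun xy => xy.1 - xy.2 = g).card : ℤ) = if g ∈ D then lam else mu)

noncomputable instance (p n : ℕ) [Fact p.Prime] : Fintype (GaloisField p n) :=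
  Fintype.ofFinite _

/-- The canonical additive character `ψ₁(x) = ω_p^{Tr(x)}` of `F_{p^n}`,
where `ω_p = exp(2πi/p)` and `Tr` is the absolute trace. -/
def psi (p n : ℕ) [Fact p.Prime] (x : GaloisField p n) : ℂ :=
  Complex.exp (2 * Real.pi * Complex.I *
    ((Algebra.trace (ZMod p) (GaloisField p n) x).val : ℂ) / p)

/-- The cyclotomic class `C_i = {g^{i+ej} : 0 ≤ j ≤ f-1}` of order `e`
with respect to the primitive element `g`. -/
def cycClass (p n : ℕ) [Fact p.Prime] (g : GaloisField p n) (e f i : ℕ) :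
    Finset (GaloisField p n) :=
  (Finset.range f).image fun j => g ^ (i + e * j)

/-- The polar form `B(x,y) = Q(x+y) − Q(x) − Q(y)` of `Q`. -/
def polarForm {F V : Type*} [Field F] [AddCommGroup V] (Q : V → F) (x y : V) : F :=
  Q (x + y) - Q x - Q y

theorem IsCyclic.exists_pow_eq_iff {G : Type*} [CommGroup G] [Finite G] [IsCyclic G] {d k : ℕ}
    (h : Nat.card G = d * k) (u : G) : (∃ v, v ^ d = u) ↔ u ^ k = 1 := by
  constructor
  · rintro ⟨v, rfl⟩
    rw [← pow_mul, ← h, pow_card_eq_one']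
  · intro hu
    obtain ⟨g, hg⟩ := IsCyclic.exists_generator (α := G)
    obtain ⟨n, rfl⟩ := mem_powers_iff_mem_zpowers.2 (hg u)
    have hk : 0 < k := by
      rcases Nat.eq_zero_or_pos k with rfl | hk
      · exact absurd h (by simpa using Nat.card_pos.ne')
      · exact hk
    simp only [← pow_mul] at hu
    have h1 := orderOf_dvd_of_pow_eq_one hu
    rw [orderOf_eq_card_of_forall_mem_zpowers hg, h] at h1
    obtain ⟨t, rfl⟩ := Nat.dvd_of_mul_dvd_mul_right hk h1
    exact ⟨g ^ t, by simp only [← pow_mul]; rw [mul_comm]⟩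

theorem IsCyclic.card_filter_pow_eq_one {G : Type*} [CommGroup G] [Fintype G] [DecidableEq G]
    [IsCyclic G] {d : ℕ}
    (h : d ∣ Nat.card G) : (univ.filter fun y : G => y ^ d = 1).card = d := by
  have h1 := IsCyclic.card_powMonoidHom_ker (G := G) d
  rw [Nat.gcd_eq_right h] at h1
  refine Eq.trans ?_ h1
  rw [Nat.card_eq_fintype_card, Fintype.card_subtype]
  congr 1
  ext
  simp [MonoidHom.mem_ker]

theorem IsCyclic.sum_pow_eq {G : Type*} [CommGroup G] [Fintype G] [DecidableEq G]
    [IsCyclic G] {d : ℕ}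
    (h : d ∣ Nat.card G) (φ : G → ℂ) :
    ∑ y : G, φ (y ^ d) = d * ∑ u with (∃ v, v ^ d = u), φ u := by
  rw [← Finset.sum_fiberwise_of_maps_to (s := univ) (t := univ.filter fun u : G => ∃ v, v ^ d = u)
    (g := fun y : G => y ^ d) (by simp), mul_sum]
  refine sum_congr rfl fun u hu => ?_
  obtain ⟨v, rfl⟩ := (mem_filter.1 hu).2
  rw [sum_congr rfl (g := fun _ => φ (v ^ d)) (fun y hy => by rw [(mem_filter.1 hy).2]),
    sum_const, nsmul_eq_mul]
  congr 2
  refine Eq.trans ?_ (IsCyclic.card_filter_pow_eq_one h)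
  refine card_bij (fun y _ => y * v⁻¹) (fun y hy => ?_) (fun _ _ _ _ h => mul_right_cancel h)
    (fun y hy => ⟨y * v, ?_, by simp⟩)
  · simpa [mul_pow, mul_inv_eq_one] using hy
  · simpa [mul_pow] using hy

theorem sum_eq_add_sum_units {F : Type*} [Field F] [Fintype F] (φ : F → ℂ) :
    ∑ x, φ x = φ 0 + ∑ x : Fˣ, φ x := by
  rw [← Finset.add_sum_erase univ φ (mem_univ 0)]
  congr 1
  symm
  refine sum_bij (fun x _ => (x : F)) (fun x _ => by simp) (fun _ _ _ _ h => Units.ext h)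
    (fun y hy => ⟨Units.mk0 y (by simpa using hy), mem_univ _, rfl⟩) (fun _ _ => rfl)

theorem neg_one_pow_eq_one {F : Type*} [Field F] {r : ℕ}
    (hadd : ∀ x y : F, (x + y) ^ r = x ^ r + y ^ r) (hr : 2 ≤ r) (k : ℕ) :
    (-1 : Fˣ) ^ ((r - 1) * k) = 1 ∧ (-1 : Fˣ) ^ ((r + 1) * k) = 1 := by
  rcases Nat.even_or_odd r with he | ho
  · have h := hadd 1 (-1)
    have h2 : (-1 : Fˣ) = 1 := by
      ext
      simp only [add_neg_cancel, one_pow, he.neg_one_pow, zero_pow (by omega : r ≠ 0)] at h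
      push_cast
      linear_combination h
    simp [h2]
  · have h1 : Even (r - 1) := by grind
    have h2 : Even (r + 1) := by grind
    rw [pow_mul, pow_mul, h1.neg_one_pow, h2.neg_one_pow]; simp

section SemiprimitivePeriods

variable {F : Type*} [Field F] [Fintype F] {ψ : AddChar F ℂ} {r M : ℕ}

/-- The exponential sum `∑ x, ψ (α * x ^ n)`. -/
def powSum (ψ : AddChar F ℂ) (n : ℕ) (α : F) : ℂ := ∑ x, ψ (α * x ^ n)

theorem powSum_mul_pow (n : ℕ) (α : F) {ζ : F} (hζ : ζ ≠ 0) :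
    powSum ψ n (α * ζ ^ n) = powSum ψ n α := by
  unfold powSum
  rw [← Equiv.sum_comp (Equiv.mulLeft₀ ζ hζ) fun x => ψ (α * x ^ n)]
  simp [mul_pow, mul_assoc]

theorem powSum_eq_one_add {n : ℕ} (hn : n ≠ 0) (α : F) :
    powSum ψ n α = 1 + ∑ x : Fˣ, ψ (α * x ^ n) := by
  rw [powSum, sum_eq_add_sum_units]
  simp [hn]

theorem sum_units_mul (hψ : ψ.IsPrimitive) {β : F} (hβ : β ≠ 0) : ∑ x : Fˣ, ψ (x * β) = -1 := by
  have h := AddChar.sum_mulShift (R := F) β hψ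
  rw [sum_eq_add_sum_units, if_neg hβ] at h
  simp only [zero_mul, AddChar.map_zero_eq_one, Nat.cast_zero] at h
  linear_combination h

theorem powSum_neg (hadd : ∀ x y : F, (x + y) ^ r = x ^ r + y ^ r) (hr : 2 ≤ r)
    (hM : Nat.card Fˣ = (r + 1) * ((r - 1) * M)) (α : F) :
    powSum ψ (r + 1) (-α) = powSum ψ (r + 1) α := by
  obtain ⟨ζ, hζ⟩ := (IsCyclic.exists_pow_eq_iff hM (-1)).2 (neg_one_pow_eq_one hadd hr M).1
  have h : (ζ : F) ^ (r + 1) = -1 := by simpa using congrArg Units.val hζ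
  rw [← powSum_mul_pow (r + 1) α ζ.ne_zero, h, mul_neg_one]

theorem powSum_sq (hψ : ψ.IsPrimitive) (hadd : ∀ x y : F, (x + y) ^ r = x ^ r + y ^ r)
    (hr : 2 ≤ r) (hψr : ∀ x, ψ (x ^ r) = ψ x)
    (hM : Nat.card Fˣ = (r + 1) * ((r - 1) * M)) (α : F) :
    powSum ψ (r + 1) α ^ 2 = Fintype.card F *
      ∑ x with α ^ r * x ^ r ^ 2 + α * x = 0, ψ (α * x ^ (r + 1)) := by
  have hinj : Function.Injective fun x : F => x ^ r := fun x y hxy => by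
    have h := hadd (x - y) y
    simp only [sub_add_cancel] at h hxy
    have : (x - y) ^ r = 0 := by linear_combination hxy - h
    exact sub_eq_zero.1 (pow_eq_zero_iff (by omega) |>.1 this)
  have hbij := Finite.injective_iff_bijective.1 hinj
  have hinner : ∀ x : F, ∑ y, ψ (α * (x ^ r * y + x * y ^ r)) =
      if α ^ r * x ^ r ^ 2 + α * x = 0 then (Fintype.card F : ℂ) else 0 := fun x => by
    have h := AddChar.sum_mulShift (R := F) (α ^ r * x ^ r ^ 2 + α * x) hψ
    rw [← hbij.sum_comp] at h
    rw [Nat.cast_ite, Nat.cast_zero] at h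
    rw [← h]
    refine sum_congr rfl fun y _ => ?_
    rw [mul_add, AddChar.map_add_eq_mul, ← hψr (α * (x ^ r * y)), ← AddChar.map_add_eq_mul]
    congr 1
    ring
  calc powSum ψ (r + 1) α ^ 2
      = powSum ψ (r + 1) (-α) * powSum ψ (r + 1) α := by rw [powSum_neg hadd hr hM, sq]
    _ = ∑ y, ∑ x, ψ (-α * y ^ (r + 1)) * ψ (α * (x + y) ^ (r + 1)) := by
        unfold powSum
        rw [sum_mul]
        refine sum_congr rfl fun y _ => ?_
        rw [mul_sum, ← Equiv.sum_comp (Equiv.addRight y)]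
        rfl
    _ = ∑ x, ∑ y, ψ (α * x ^ (r + 1)) * ψ (α * (x ^ r * y + x * y ^ r)) := by
        rw [sum_comm]
        refine sum_congr rfl fun x _ => sum_congr rfl fun y _ => ?_
        rw [← AddChar.map_add_eq_mul, ← AddChar.map_add_eq_mul, pow_succ (x + y), hadd]
        congr 1
        ring
    _ = _ := by
        simp_rw [← mul_sum, hinner, mul_ite, mul_zero]
        rw [← sum_filter, mul_sum]
        exact sum_congr rfl fun _ _ => mul_comm _ _

theorem map_eq_one_of_pow_eq_neg (hadd : ∀ x y : F, (x + y) ^ r = x ^ r + y ^ r)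
    (hr : 2 ≤ r) (hψr : ∀ x, ψ (x ^ r) = ψ x)
    (hM : Nat.card Fˣ = (r + 1) * ((r - 1) * M)) {t : F} (ht : t ^ r = -t) : ψ t = 1 := by
  have hex : ∃ u : Fˣ, u ^ ((r + 1) * (r - 1)) = 1 ∧ u ^ (2 * (r - 1)) ≠ 1 := by
    by_contra! hcon
    have h1 := IsCyclic.card_filter_pow_eq_one (G := Fˣ) (d := (r + 1) * (r - 1))
      ⟨M, by rw [hM, mul_assoc]⟩
    have h2 := IsCyclic.card_pow_eq_one_le (α := Fˣ) (n := 2 * (r - 1)) (by omega)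
    have h3 := card_le_card (monotone_filter_right (univ : Finset Fˣ) fun u _ => hcon u)
    rw [h1] at h3
    have h4 := Nat.le_of_mul_le_mul_right (h3.trans h2) (by omega)
    omega
  obtain ⟨u, hu1, hu2⟩ := hex
  obtain ⟨n, rfl⟩ : ∃ n, r = n + 1 := ⟨r - 1, by omega⟩
  simp only [Nat.add_sub_cancel] at hu1 hu2
  have hu1' : (u : F) ^ ((n + 1 + 1) * n) = 1 := by simpa using congrArg Units.val hu1
  have hθ : (u : F) + (u : F) ^ (n + 1) ≠ 0 := fun h => hu2 <| by
    ext
    have h5 : (u : F) ^ n = -1 := mul_right_cancel₀ u.ne_zero (by linear_combination h)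
    push_cast
    rw [mul_comm, pow_mul, h5]
    norm_num
  have hθr : ((u : F) ^ (n + 1)) ^ (n + 1) = u := by
    linear_combination (u : F) * hu1'
  have hw : (u * t / ((u : F) + (u : F) ^ (n + 1))) ^ (n + 1) =
      u * t / ((u : F) + (u : F) ^ (n + 1)) - t := by
    rw [div_pow, mul_pow, hadd, hθr, ht, add_comm ((u : F) ^ (n + 1))]
    field_simp
    ring
  have h := hψr (u * t / ((u : F) + (u : F) ^ (n + 1)))
  rw [hw, AddChar.map_sub_eq_div] at h
  have h0 : ψ (u * t / ((u : F) + (u : F) ^ (n + 1))) ≠ 0 :=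
    (AddChar.val_isUnit ψ _).ne_zero
  have h1 : ψ t ≠ 0 := (AddChar.val_isUnit ψ _).ne_zero
  field_simp at h
  exact h.symm

theorem powSum_sq_eq_ite (hψ : ψ.IsPrimitive) (hadd : ∀ x y : F, (x + y) ^ r = x ^ r + y ^ r)
    (hr : 2 ≤ r) (hψr : ∀ x, ψ (x ^ r) = ψ x)
    (hM : Nat.card Fˣ = (r + 1) * ((r - 1) * M)) {z : Fˣ} (hz : (z : F) ^ r = -z) (α : Fˣ) :
    powSum ψ (r + 1) (α : F) ^ 2 =
      Fintype.card F * if ∃ v, v ^ (r + 1) = α / z then (r : ℂ) ^ 2 else 1 := by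
  rw [powSum_sq hψ hadd hr hψr hM]
  congr 1
  have hpow : ∀ x : F, (α : F) ^ r * x ^ r ^ 2 + α * x = 0 →
      ((α : F) * x ^ (r + 1)) ^ r = -(α * x ^ (r + 1)) := fun x hx => by
    linear_combination x ^ r * hx
  rw [sum_congr rfl (g := fun _ => (1 : ℂ)) (fun x hx =>
    map_eq_one_of_pow_eq_neg hadd hr hψr hM (hpow x (mem_filter.1 hx).2)),
    sum_const, nsmul_eq_mul, mul_one]
  split_ifs with hv
  · obtain ⟨v, hv⟩ := hv
    have hα : (α : F) = z * v ^ (r + 1) := by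
      have : α = z * v ^ (r + 1) := by rw [hv]; simp
      rw [this]; simp
    norm_cast
    have hcard : #{y : Fˣ | y ^ ((r + 1) * (r - 1)) = 1} = (r + 1) * (r - 1) :=
      IsCyclic.card_filter_pow_eq_one ⟨M, by rw [hM, mul_assoc]⟩
    have hiff : ∀ y : F, (α : F) ^ r * ((v⁻¹ : Fˣ) * y) ^ r ^ 2 + α * ((v⁻¹ : Fˣ) * y) = 0 ↔
        y ^ r ^ 2 = y := fun y => by
      have h1 : (α : F) ^ r * ((v⁻¹ : Fˣ) * y) ^ r ^ 2 + α * ((v⁻¹ : Fˣ) * y) =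
          -(z * v ^ r) * (y ^ r ^ 2 - y) := by
        rw [hα, mul_pow _ _ r, hz, mul_pow _ _ (r ^ 2), ← pow_mul,
          show (r + 1) * r = r ^ 2 + r by ring, pow_add (v : F) (r ^ 2), pow_succ (v : F) r]
        have h2 : (v : F) * (v⁻¹ : Fˣ) = 1 := by simp
        have h3 : (v : F) ^ r ^ 2 * ((v⁻¹ : Fˣ) : F) ^ r ^ 2 = 1 := by
          rw [← mul_pow, h2, one_pow]
        linear_combination (-(z : F) * v ^ r * y ^ r ^ 2) * h3 + (z : F) * v ^ r * y * h2
      rw [h1, mul_eq_zero, sub_eq_zero, neg_eq_zero]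
      simp
    have hunit : ∀ y : Fˣ, (y : F) ^ r ^ 2 = y ↔ y ^ ((r + 1) * (r - 1)) = 1 := fun y => by
      have h2 : r ^ 2 = (r + 1) * (r - 1) + 1 := by
        obtain ⟨n, rfl⟩ : ∃ n, r = n + 1 := ⟨r - 1, by omega⟩
        simp only [Nat.add_sub_cancel]
        ring
      rw [h2, pow_succ, Units.ext_iff]
      simp
    have hsum : (#{x : F | (α : F) ^ r * x ^ r ^ 2 + α * x = 0} : ℂ) = ((r ^ 2 : ℕ) : ℂ) := by
      rw [card_filter]
      push_cast
      rw [← Equiv.sum_comp (Equiv.mulLeft₀ ((v⁻¹ : Fˣ) : F) (Units.ne_zero _))]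
      simp only [Equiv.mulLeft₀_apply, hiff]
      rw [sum_eq_add_sum_units]
      simp only [hunit]
      rw [if_pos (zero_pow (by positivity)), ← Nat.cast_one, ← Nat.cast_zero]
      simp only [← Nat.cast_ite]
      rw [← Nat.cast_sum, ← card_filter, hcard, ← Nat.cast_add, ← Nat.cast_pow]
      congr 1
      obtain ⟨n, rfl⟩ : ∃ n, r = n + 1 := ⟨r - 1, by omega⟩
      simp only [Nat.add_sub_cancel]
      ring
    exact_mod_cast hsum
  · rw [Nat.cast_eq_one, card_eq_one]
    refine ⟨0, ?_⟩
    ext x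
    simp only [mem_filter, mem_univ, true_and, mem_singleton]
    constructor
    · intro hx
      by_contra hx0
      refine hv ?_
      set y := Units.mk0 x hx0
      have h1 := hpow x hx
      obtain ⟨n, rfl⟩ : ∃ n, r = n + 1 := ⟨r - 1, by omega⟩
      have h2 : (α * y ^ (n + 1 + 1) / z) ^ n = 1 := by
        rw [div_pow, div_eq_one]
        have h3 : ∀ a : Fˣ, (a : F) ^ (n + 1) = -a → a ^ n = -1 := fun a ha => by
          ext
          push_cast
          exact mul_right_cancel₀ a.ne_zero (by linear_combination ha)
        rw [h3 z hz, h3 _ (by simpa [y] using h1)]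
      obtain ⟨v, hv'⟩ := (IsCyclic.exists_pow_eq_iff hM (α * y ^ (n + 1 + 1) / z)).2 (by
        rw [Nat.add_sub_cancel, pow_mul, h2, one_pow])
      refine ⟨v / y, ?_⟩
      rw [div_pow, hv']
      rw [div_right_comm, mul_div_cancel_right]
    · rintro rfl
      simp [show r ≠ 0 by omega]

theorem sum_units_powSum (hψ : ψ.IsPrimitive) {n : ℕ} (hn : n ≠ 0) :
    ∑ α : Fˣ, powSum ψ n (α : F) = 0 := by
  simp_rw [powSum_eq_one_add hn]
  rw [sum_add_distrib, sum_comm]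
  rw [sum_congr rfl (g := fun _ : Fˣ => (-1 : ℂ))
    (fun x _ => sum_units_mul hψ (pow_ne_zero n x.ne_zero)), ← sum_add_distrib]
  simp

theorem card_pow_mul (hM : Nat.card Fˣ = (r + 1) * ((r - 1) * M)) :
    ((r : ℂ) + 1) * #{u : Fˣ | ∃ v, v ^ (r + 1) = u} = Fintype.card Fˣ := by
  have h := IsCyclic.sum_pow_eq (G := Fˣ) ⟨_, hM⟩ fun _ => (1 : ℂ)
  simp only [sum_const, nsmul_eq_mul, mul_one, card_univ] at h
  rw [h]
  push_cast
  rfl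

/-- The uniform values of the exponential sums of exponent `r + 1` over a field of order a power
of `r ^ 2`. -/
theorem exists_powSum_eq (hψ : ψ.IsPrimitive) (hadd : ∀ x y : F, (x + y) ^ r = x ^ r + y ^ r)
    (hr : 2 ≤ r) (hψr : ∀ x, ψ (x ^ r) = ψ x)
    (hM : Nat.card Fˣ = (r + 1) * ((r - 1) * M)) :
    ∃ (s : ℂ) (z : Fˣ), s ^ 2 = Fintype.card F ∧ ∀ α : Fˣ, powSum ψ (r + 1) (α : F) =
      -s + if ∃ v, v ^ (r + 1) = α / z then (r + 1) * s else 0 := by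
  obtain ⟨z, hz⟩ := (IsCyclic.exists_pow_eq_iff (G := Fˣ) (d := r - 1) (k := (r + 1) * M)
    (by rw [hM]; ring) (-1)).2 (neg_one_pow_eq_one hadd hr M).2
  have hzr : (z : F) ^ r = -z := by
    have h1 : (z : F) ^ (r - 1) = -1 := by simpa using congrArg Units.val hz
    rw [← Nat.sub_add_cancel (show 1 ≤ r by omega), pow_succ, h1, neg_one_mul]
  have hr0 : (r : ℂ) ≠ 0 := by exact_mod_cast (by omega : r ≠ 0)
  have hsq := powSum_sq_eq_ite hψ hadd hr hψr hM hzr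
  have hs2 : (powSum ψ (r + 1) (z : F) / r) ^ 2 = Fintype.card F := by
    rw [div_pow, hsq z, if_pos ⟨1, by simp⟩]
    field_simp
  set s := powSum ψ (r + 1) (z : F) / r with hs
  have hs0 : s ≠ 0 := by
    rintro h0
    rw [h0] at hs2
    norm_num at hs2
    exact Fintype.card_ne_zero (α := F) (by exact_mod_cast hs2.symm)
  have hn : ∀ u : Fˣ, ∃ n : ℕ, powSum ψ (r + 1) ((z * u : Fˣ) : F) + s -
      (if ∃ v, v ^ (r + 1) = u then (r + 1) * s else 0) = s * n := fun u => by
    have h := hsq (z * u)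
    rw [mul_div_cancel_left] at h
    split_ifs with hv
    · obtain ⟨v, rfl⟩ := hv
      refine ⟨0, ?_⟩
      push_cast
      rw [powSum_mul_pow (r + 1) (z : F) v.ne_zero, hs]
      field_simp
      ring
    · rw [if_neg hv, mul_one, ← hs2, sq_eq_sq_iff_eq_or_eq_neg] at h
      rcases h with h | h
      · exact ⟨2, by rw [h]; push_cast; ring⟩
      · exact ⟨0, by rw [h]; push_cast; ring⟩
  choose n hn using hn
  have htrans : ∑ u : Fˣ, powSum ψ (r + 1) ((z * u : Fˣ) : F) = 0 :=
    (Equiv.sum_comp (Equiv.mulLeft z) fun u : Fˣ => powSum ψ (r + 1) (u : F)).trans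
      (sum_units_powSum hψ (Nat.succ_ne_zero r))
  have hsum : s * ((∑ u, n u : ℕ) : ℂ) = 0 := by
    push_cast
    rw [mul_sum, ← sum_congr rfl (fun u _ => hn u), sum_sub_distrib, sum_add_distrib,
      htrans, ← sum_filter, sum_const, sum_const, card_univ,
      nsmul_eq_mul, nsmul_eq_mul]
    linear_combination -s * card_pow_mul hM
  have hn0 : ∀ u, n u = 0 := by
    have h := (mul_eq_zero.1 hsum).resolve_left hs0
    have h' : ∑ u, n u = 0 := by exact_mod_cast h
    simpa using h'
  refine ⟨s, z, hs2, fun α => ?_⟩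
  have h := hn (α / z)
  rw [hn0, mul_div_cancel] at h
  linear_combination h

theorem exists_sum_kloosterman_mul_pow (hψ : ψ.IsPrimitive)
    (hadd : ∀ x y : F, (x + y) ^ r = x ^ r + y ^ r)
    (hr : 2 ≤ r) (hψr : ∀ x, ψ (x ^ r) = ψ x)
    (hM : Nat.card Fˣ = (r + 1) * ((r - 1) * M)) (a : Fˣ) :
    ∃ w : Fˣ, ∀ c : Fˣ, ∑ x : Fˣ, ∑ α : Fˣ, ψ (α * (c * x ^ (r + 1) : Fˣ) + (a * α⁻¹ : Fˣ)) =
      1 - Fintype.card F +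
        if ∃ v, v ^ (r + 1) = c / w then (r + 1) * (Fintype.card F : ℂ) else 0 := by
  obtain ⟨s, z, hs, hS⟩ := exists_powSum_eq hψ hadd hr hψr hM
  refine ⟨z ^ 2 / a, fun c => ?_⟩
  have hsub : ∀ β : Fˣ, ∑ x : Fˣ, ψ ((β : F) * x ^ (r + 1)) =
      -s - 1 + if ∃ v, v ^ (r + 1) = β / z then (r + 1) * s else 0 := fun β => by
    have h1 := powSum_eq_one_add (ψ := ψ) (Nat.succ_ne_zero r) (β : F)
    rw [hS] at h1
    linear_combination -h1
  have hinv : ∀ u : Fˣ, (∃ v, v ^ (r + 1) = u⁻¹) ↔ ∃ v, v ^ (r + 1) = u := fun u =>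
    ⟨fun ⟨v, hv⟩ => ⟨v⁻¹, by rw [inv_pow, hv, inv_inv]⟩, fun ⟨v, hv⟩ => ⟨v⁻¹, by rw [inv_pow, hv]⟩⟩
  have h1 : ∑ α : Fˣ, ψ ((a * α⁻¹ : Fˣ) : F) = -1 := by
    rw [← Equiv.sum_comp (Equiv.inv Fˣ)]
    simp only [Equiv.inv_apply, inv_inv]
    rw [← sum_units_mul hψ a.ne_zero]
    exact sum_congr rfl fun x _ => by rw [Units.val_mul, mul_comm]
  have h2 : ∑ α : Fˣ, ψ ((a * α⁻¹ : Fˣ) : F) *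
      (if ∃ v, v ^ (r + 1) = α * c / z then (r + 1) * s else 0) =
        s * ∑ y : Fˣ, ψ ((a * c / z : Fˣ) * y ^ (r + 1) : F) := by
    have h3 := IsCyclic.sum_pow_eq (G := Fˣ) ⟨_, hM⟩ fun u => ψ ((a * c / z * u : Fˣ) : F)
    push_cast at h3
    push_cast
    rw [h3, ← Equiv.sum_comp ((Equiv.inv Fˣ).trans (Equiv.mulLeft (z / c))), sum_filter, mul_sum,
      mul_sum]
    refine sum_congr rfl fun u _ => ?_
    have h4 : z / c * u⁻¹ * c / z = u⁻¹ := by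
      rw [mul_right_comm, div_mul_cancel, mul_div_cancel_left]
    simp only [Equiv.trans_apply, Equiv.inv_apply, Equiv.coe_mulLeft, h4, hinv]
    split_ifs with hu
    · have h5 : (a : F) * ((z / c * u⁻¹ : Fˣ) : F)⁻¹ = a * c / z * u := by
        push_cast
        have := u.ne_zero
        field_simp
      rw [h5]
      ring
    · ring
  rw [sum_comm]
  have h6 : ∀ α : Fˣ, ∑ x : Fˣ, ψ (α * (c * x ^ (r + 1) : Fˣ) + (a * α⁻¹ : Fˣ)) =
      ψ ((a * α⁻¹ : Fˣ) : F) * (-s - 1) + ψ ((a * α⁻¹ : Fˣ) : F) *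
        (if ∃ v, v ^ (r + 1) = α * c / z then (r + 1) * s else 0) := fun α => by
    rw [← mul_add, ← hsub, mul_sum]
    refine sum_congr rfl fun x _ => ?_
    rw [← AddChar.map_add_eq_mul]
    push_cast
    congr 1
    ring
  rw [sum_congr rfl fun α _ => h6 α, sum_add_distrib, ← sum_mul, h1, h2, hsub]
  have h7 : a * c / z / z = c / (z ^ 2 / a) := by
    rw [div_div_eq_mul_div, div_div, sq, mul_comm a c]
  rw [h7]
  split_ifs
  · linear_combination (r : ℂ) * hs
  · linear_combination -hs

/-- Kloosterman sums, summed over a set stable under multiplication by `(r + 1)`-th powers,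
take only two values. -/
theorem sum_kloosterman_eq_or (hψ : ψ.IsPrimitive)
    (hadd : ∀ x y : F, (x + y) ^ r = x ^ r + y ^ r)
    (hr : 2 ≤ r) (hψr : ∀ x, ψ (x ^ r) = ψ x)
    (hM : Nat.card Fˣ = (r + 1) * ((r - 1) * M)) (a : Fˣ) (C : Finset Fˣ)
    (hC : ∀ c ∈ C, ∀ x : Fˣ, c * x ^ (r + 1) ∈ C) :
    ∑ c ∈ C, ∑ α : Fˣ, ψ (α * c + (a * α⁻¹ : Fˣ)) = -(#C : ℂ) ∨
      ∑ c ∈ C, ∑ α : Fˣ, ψ (α * c + (a * α⁻¹ : Fˣ)) = Fintype.card F - (#C : ℂ) := by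
  obtain ⟨w, hw⟩ := exists_sum_kloosterman_mul_pow hψ hadd hr hψr hM a
  set h : Fˣ → ℂ := fun c => ∑ α : Fˣ, ψ (α * c + (a * α⁻¹ : Fˣ)) with hh
  change ∑ c ∈ C, h c = _ ∨ ∑ c ∈ C, h c = _
  replace hw : ∀ c, ∑ x : Fˣ, h (c * x ^ (r + 1)) = _ := hw
  have hcard : (Fintype.card Fˣ : ℂ) = Fintype.card F - 1 := by
    rw [Fintype.card_units, Nat.cast_sub Fintype.card_pos, Nat.cast_one]
  have hcard0 : (Fintype.card Fˣ : ℂ) ≠ 0 := by exact_mod_cast Fintype.card_ne_zero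
  have hinvar : ∀ x : Fˣ, ∑ c ∈ C, h (c * x ^ (r + 1)) = ∑ c ∈ C, h c := fun x =>
    sum_bij (fun c _ => c * x ^ (r + 1)) (fun c hc => hC c hc x)
      (fun _ _ _ _ h => mul_right_cancel h)
      (fun c hc => ⟨c * x⁻¹ ^ (r + 1), hC c hc x⁻¹, by simp⟩) (fun _ _ => rfl)
  have hmain : (Fintype.card Fˣ : ℂ) * ∑ c ∈ C, h c =
      -(Fintype.card Fˣ) * #C +
        Fintype.card F * ((r + 1) * #{c ∈ C | ∃ v, v ^ (r + 1) = c / w}) := by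
    calc _ = ∑ x : Fˣ, ∑ c ∈ C, h (c * x ^ (r + 1)) := by simp [hinvar]
      _ = _ := by
        rw [sum_comm, sum_congr rfl fun c _ => hw c, sum_add_distrib, ← sum_filter, sum_const,
          sum_const, nsmul_eq_mul, nsmul_eq_mul, hcard]
        ring
  by_cases hne : ∃ c ∈ C, ∃ v, v ^ (r + 1) = c / w
  · right
    obtain ⟨c₀, hc₀, v₀, hv₀⟩ := hne
    have hfull : #{c ∈ C | ∃ v, v ^ (r + 1) = c / w} = #{u : Fˣ | ∃ v, v ^ (r + 1) = u} := by
      refine card_bij (fun c _ => c / w) (fun c hc => ?_) (fun _ _ _ _ h => div_left_injective h)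
        (fun u hu => ?_)
      · simpa using (mem_filter.1 hc).2
      · obtain ⟨v, rfl⟩ := (mem_filter.1 hu).2
        refine ⟨v ^ (r + 1) * w, mem_filter.2 ⟨?_, v, by simp⟩, by simp⟩
        have : v ^ (r + 1) * w = c₀ * (v / v₀) ^ (r + 1) := by
          rw [div_pow, hv₀, div_div_eq_mul_div, mul_div_cancel]
        rw [this]
        exact hC c₀ hc₀ _
    rw [hfull, card_pow_mul hM] at hmain
    refine mul_left_cancel₀ hcard0 ?_
    rw [hmain]
    ring
  · left
    rw [filter_eq_empty_iff.2 fun c hc hv => hne ⟨c, hc, hv⟩] at hmain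
    refine mul_left_cancel₀ hcard0 ?_
    rw [hmain, card_empty, Nat.cast_zero]
    ring

end SemiprimitivePeriods

/-- Counting differences in a symmetric set with two nontrivial character values. -/
theorem card_mul_card_sub_eq {G : Type*} [AddCommGroup G] [Fintype G] (D : Finset G)
    (χ : G → AddChar G ℂ) (hχ0 : ∀ x, χ 0 x = 1) (horth : ∀ x ≠ 0, ∑ b, χ b x = 0)
    (hneg : ∀ x ∈ D, -x ∈ D) {θ₁ θ₂ : ℂ}
    (hθ : ∀ b ≠ 0, ∑ x ∈ D, χ b x = θ₁ ∨ ∑ x ∈ D, χ b x = θ₂) {g : G} (hg : g ≠ 0) :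
    (Fintype.card G : ℂ) * #{xy ∈ D ×ˢ D | xy.1 - xy.2 = g} =
      (θ₁ + θ₂) * (if g ∈ D then (Fintype.card G : ℂ) else 0) + (#D - θ₁) * (#D - θ₂) := by
  have hdelta : ∀ x, ∑ b, χ b x = if x = 0 then (Fintype.card G : ℂ) else 0 := fun x => by
    split_ifs with h
    · simp [h]
    · exact horth x h
  have hnegsum : ∀ b, ∑ y ∈ D, χ b (-y) = ∑ y ∈ D, χ b y := fun b =>
    sum_bij (fun y _ => -y) (fun y hy => hneg y hy) (fun _ _ _ _ h => neg_injective h)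
      (fun y hy => ⟨-y, hneg y hy, neg_neg y⟩) (fun _ _ => rfl)
  have hsq : ∀ b, (∑ x ∈ D, χ b x) ^ 2 = (θ₁ + θ₂) * ∑ x ∈ D, χ b x - θ₁ * θ₂ +
      if b = 0 then ((#D : ℂ) - θ₁) * (#D - θ₂) else 0 := fun b => by
    split_ifs with hb
    · simp only [hb, hχ0, sum_const, nsmul_eq_mul, mul_one]
      ring
    · rcases hθ b hb with h | h <;> rw [h] <;> ring
  have h1 : ∑ b, (∑ x ∈ D, χ b x) * χ b (-g) = if g ∈ D then (Fintype.card G : ℂ) else 0 := by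
    simp_rw [sum_mul, ← AddChar.map_add_eq_mul]
    rw [sum_comm]
    simp_rw [hdelta, ← sub_eq_add_neg, sub_eq_zero]
    rw [sum_ite_eq' D g]
  calc (Fintype.card G : ℂ) * #{xy ∈ D ×ˢ D | xy.1 - xy.2 = g}
      = ∑ xy ∈ D ×ˢ D, ∑ b, χ b (xy.1 + -xy.2 + -g) := by
        simp_rw [hdelta, ← sub_eq_add_neg, sub_eq_zero]
        rw [← sum_filter, sum_const, nsmul_eq_mul, mul_comm]
    _ = ∑ b, (∑ x ∈ D, χ b x) ^ 2 * χ b (-g) := by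
        rw [sum_comm]
        refine sum_congr rfl fun b _ => ?_
        simp_rw [AddChar.map_add_eq_mul]
        rw [← sum_mul, sq]
        nth_rewrite 2 [← hnegsum b]
        rw [sum_mul_sum, sum_product]
    _ = ∑ b, ((θ₁ + θ₂) * ((∑ x ∈ D, χ b x) * χ b (-g)) - θ₁ * θ₂ * χ b (-g) +
          if b = 0 then ((#D : ℂ) - θ₁) * (#D - θ₂) else 0) := by
        refine sum_congr rfl fun b _ => ?_
        rw [hsq]
        split_ifs with hb
        · rw [hb, hχ0]
          ring
        · ring
    _ = _ := by
        rw [sum_add_distrib, sum_sub_distrib, ← mul_sum, h1, ← mul_sum,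
          horth _ (neg_ne_zero.2 hg)]
        simp

theorem polarForm_comm {F V : Type*} [Field F] [AddCommGroup V] (Q : V → F) (x y : V) :
    polarForm Q x y = polarForm Q y x := by
  unfold polarForm
  rw [add_comm]
  ring

section QuadraticForm

variable {F V : Type*} [Field F] [AddCommGroup V] [Module F V] [Fintype V]
  {ψ : AddChar F ℂ} {Q : V → F}

/-- The additive character `x ↦ ψ (B(b, x))` attached to the polar form `B` of `Q`. -/
def polarChar (ψ : AddChar F ℂ) (Q : V → F)
    (hBadd : ∀ x y z, polarForm Q (x + y) z = polarForm Q x z + polarForm Q y z) (b : V) :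
    AddChar V ℂ where
  toFun x := ψ (polarForm Q x b)
  map_zero_eq_one' := by
    have h := hBadd 0 0 b
    rw [add_zero, left_eq_add] at h
    rw [h, AddChar.map_zero_eq_one]
  map_add_eq_mul' x y := by rw [hBadd, AddChar.map_add_eq_mul]

theorem sum_polarForm_eq_zero (hψ : ψ.IsPrimitive)
    (hBadd : ∀ x y z, polarForm Q (x + y) z = polarForm Q x z + polarForm Q y z)
    (hBsmul : ∀ (a : F) x y, polarForm Q (a • x) y = a * polarForm Q x y)
    (hBnd : ∀ x, (∀ y, polarForm Q x y = 0) → x = 0) {b : V} (hb : b ≠ 0) :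
    ∑ x, ψ (polarForm Q x b) = 0 := by
  refine (AddChar.sum_eq_zero_iff_ne_zero (ψ := polarChar ψ Q hBadd b)).2 fun h => hb ?_
  refine hBnd b fun y => ?_
  rw [polarForm_comm]
  by_contra hy
  refine hψ hy ?_
  ext t
  have h2 := DFunLike.congr_fun h (t • y)
  change ψ (polarForm Q (t • y) b) = 1 at h2
  rw [hBsmul, mul_comm] at h2
  simpa using h2

theorem sum_map_mul_add_polarForm (hQ : ∀ (a : F) x, Q (a • x) = a ^ 2 * Q x)
    (hBsmul : ∀ (a : F) x y, polarForm Q (a • x) y = a * polarForm Q x y) (t : Fˣ) (b : V) :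
    ∑ x, ψ (t * Q x + polarForm Q x b) =
      ψ (-(Q b * (t⁻¹ : Fˣ))) * ∑ x, ψ (t * Q x) := by
  rw [mul_sum, ← Equiv.sum_comp (Equiv.addRight (((t⁻¹ : Fˣ) : F) • b))
    fun x => ψ (-(Q b * (t⁻¹ : Fˣ))) * ψ (t * Q x)]
  refine sum_congr rfl fun x _ => ?_
  have h1 : Q (x + ((t⁻¹ : Fˣ) : F) • b) =
      Q x + ((t⁻¹ : Fˣ) : F) ^ 2 * Q b + ((t⁻¹ : Fˣ) : F) * polarForm Q x b := by
    rw [polarForm_comm Q x b, ← hBsmul, ← hQ, polarForm_comm, polarForm]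
    ring
  have h2 : (t : F) * (t⁻¹ : Fˣ) = 1 := by simp
  rw [Equiv.coe_addRight, h1, ← AddChar.map_add_eq_mul]
  congr 1
  linear_combination (-(t⁻¹ : Fˣ) * Q b - polarForm Q x b) * h2

variable [Fintype F]

theorem card_mul_sum_map_polarForm (hψ : ψ.IsPrimitive) (hQ : ∀ (a : F) x, Q (a • x) = a ^ 2 * Q x)
    (hBsmul : ∀ (a : F) x y, polarForm Q (a • x) y = a * polarForm Q x y) {E : ℂ}
    (hE : ∀ t : F, t ≠ 0 → ∑ x, ψ (t * Q x) = E) (C : Finset Fˣ) (b : V) :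
    (Fintype.card F : ℂ) * ∑ x with ∃ c ∈ C, (c : F) = Q x, ψ (polarForm Q x b) =
      #C * ∑ x, ψ (polarForm Q x b) +
        E * ∑ c ∈ C, ∑ t : Fˣ, ψ (t * c + Q b * (t⁻¹ : Fˣ)) := by
  have hdelta : ∀ x, ∑ c ∈ C, ∑ t, ψ (t * (Q x - c)) =
      if ∃ c ∈ C, (c : F) = Q x then (Fintype.card F : ℂ) else 0 := fun x => by
    have h1 : ∀ c : Fˣ, ∑ t, ψ (t * (Q x - c)) =
        if (c : F) = Q x then (Fintype.card F : ℂ) else 0 := fun c => by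
      rw [AddChar.sum_mulShift _ hψ, Nat.cast_ite, Nat.cast_zero]
      simp only [sub_eq_zero, eq_comm]
    simp_rw [h1]
    split_ifs with h
    · obtain ⟨c, hc, hcx⟩ := h
      rw [← hcx]
      simp only [Units.val_inj]
      rw [sum_ite_eq' C c, if_pos hc]
    · exact sum_eq_zero fun c hc => if_neg fun hcx => h ⟨c, hc, hcx⟩
  have hunit : ∀ c : Fˣ, ∑ t : Fˣ, ∑ x, ψ (t * (Q x - c) + polarForm Q x b) =
      E * ∑ t : Fˣ, ψ (t * c + Q b * (t⁻¹ : Fˣ)) := fun c => by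
    rw [mul_sum, ← Equiv.sum_comp (Equiv.neg Fˣ)]
    refine sum_congr rfl fun t _ => ?_
    have h2 := sum_map_mul_add_polarForm (ψ := ψ) hQ hBsmul (-t) b
    rw [hE _ (Units.ne_zero _)] at h2
    rw [AddChar.map_add_eq_mul]
    have h3 : -(Q b * (((-t)⁻¹ : Fˣ) : F)) = Q b * (t⁻¹ : Fˣ) := by
      rw [inv_neg, Units.val_neg, mul_neg, neg_neg]
    rw [h3] at h2
    rw [mul_left_comm, mul_comm E, ← h2, mul_sum]
    refine sum_congr rfl fun x _ => ?_
    rw [← AddChar.map_add_eq_mul]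
    congr 1
    simp
    ring
  calc _ = ∑ x, (∑ c ∈ C, ∑ t, ψ (t * (Q x - c))) * ψ (polarForm Q x b) := by
        simp_rw [hdelta, ite_mul, zero_mul]
        rw [← sum_filter, mul_sum]
    _ = ∑ c ∈ C, ∑ t, ∑ x, ψ (t * (Q x - c) + polarForm Q x b) := by
        simp_rw [AddChar.map_add_eq_mul, sum_mul]
        rw [sum_comm]
        exact sum_congr rfl fun c _ => sum_comm
    _ = _ := by
        simp_rw [sum_eq_add_sum_units fun t => ∑ x, ψ (t * (Q x - _) + polarForm Q x b), hunit]
        rw [sum_add_distrib, ← mul_sum]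
        simp

/-- The points at which a nonsingular quadratic form takes values in a set stable under
multiplication by `(r + 1)`-th powers form a partial difference set. -/
theorem isPDS_quadraticForm {r M : ℕ} (hψ : ψ.IsPrimitive)
    (hadd : ∀ x y : F, (x + y) ^ r = x ^ r + y ^ r)
    (hr : 2 ≤ r) (hψr : ∀ x, ψ (x ^ r) = ψ x)
    (hM : Nat.card Fˣ = (r + 1) * ((r - 1) * M))
    (hQ : ∀ (a : F) x, Q (a • x) = a ^ 2 * Q x)
    (hBadd : ∀ x y z, polarForm Q (x + y) z = polarForm Q x z + polarForm Q y z)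
    (hBsmul : ∀ (a : F) x y, polarForm Q (a • x) y = a * polarForm Q x y)
    (hBnd : ∀ x, (∀ y, polarForm Q x y = 0) → x = 0) {N R ε : ℤ}
    (hE : ∀ t : F, t ≠ 0 → ∑ x, ψ (t * Q x) = (ε : ℂ) * N)
    (hV : (Fintype.card V : ℤ) = N ^ 2) (C : Finset Fˣ)
    (hC : ∀ c ∈ C, ∀ x : Fˣ, c * x ^ (r + 1) ∈ C) (hR : (Fintype.card F : ℤ) * R = #C * N) :
    IsPDS (univ.filter fun x => ∃ c ∈ C, (c : F) = Q x) (N ^ 2) ((N - ε) * R)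
      (ε * N + R ^ 2 - 3 * ε * R) (R ^ 2 - ε * R) := by
  have hV' : (Fintype.card V : ℂ) = (N : ℂ) ^ 2 := by exact_mod_cast hV
  have hR' : (Fintype.card F : ℂ) * R = #C * N := by exact_mod_cast hR
  have hq : (Fintype.card F : ℂ) ≠ 0 := by exact_mod_cast Fintype.card_ne_zero
  have hN : (N : ℂ) ^ 2 ≠ 0 := by rw [← hV']; exact_mod_cast Fintype.card_ne_zero
  have hpol0 : ∀ x, polarForm Q x 0 = 0 := fun x => by
    have h := hBsmul 0 0 x
    rwa [zero_smul, zero_mul, polarForm_comm] at h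
  have hQ0 : Q 0 = 0 := by simpa using hQ 0 0
  have hQneg : ∀ x, Q (-x) = Q x := fun x => by simpa using hQ (-1) x
  have hzero : ∀ b, Q b = 0 → ∑ c ∈ C, ∑ t : Fˣ, ψ (t * c + Q b * (t⁻¹ : Fˣ)) = -(#C : ℂ) :=
    fun b hb => by
      simp only [hb, zero_mul, add_zero]
      rw [sum_congr rfl fun c _ => sum_units_mul hψ (Units.ne_zero c)]
      simp
  have hsum := card_mul_sum_map_polarForm hψ hQ hBsmul hE C
  have hk : (#{x | ∃ c ∈ C, (c : F) = Q x} : ℂ) = ((N - ε) * R : ℤ) := by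
    have h := hsum 0
    rw [hzero 0 hQ0] at h
    simp only [hpol0, AddChar.map_zero_eq_one, sum_const, nsmul_eq_mul, mul_one, card_univ,
      hV'] at h
    refine mul_left_cancel₀ hq ?_
    rw [h]
    push_cast
    linear_combination (ε - N : ℂ) * hR'
  refine ⟨hV, by exact_mod_cast hk, fun g hg => ?_⟩
  have hθ : ∀ b ≠ 0, ∑ x with ∃ c ∈ C, (c : F) = Q x, ψ (polarForm Q x b) = -(ε * R : ℂ) ∨
      ∑ x with ∃ c ∈ C, (c : F) = Q x, ψ (polarForm Q x b) = ε * N - ε * R := fun b hb => by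
    have h := hsum b
    rw [sum_polarForm_eq_zero hψ hBadd hBsmul hBnd hb] at h
    have h1 : ∑ c ∈ C, ∑ t : Fˣ, ψ (t * c + Q b * (t⁻¹ : Fˣ)) = -(#C : ℂ) ∨
        ∑ c ∈ C, ∑ t : Fˣ, ψ (t * c + Q b * (t⁻¹ : Fˣ)) = Fintype.card F - (#C : ℂ) := by
      by_cases hb0 : Q b = 0
      · exact Or.inl (hzero b hb0)
      · have h2 := sum_kloosterman_eq_or hψ hadd hr hψr hM (Units.mk0 _ hb0) C hC
        simpa only [Units.val_mul, Units.val_mk0] using h2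
    refine h1.imp (fun h1 => mul_left_cancel₀ hq ?_) fun h1 => mul_left_cancel₀ hq ?_
    · rw [h, h1]
      linear_combination (ε : ℂ) * hR'
    · rw [h, h1]
      linear_combination (ε : ℂ) * hR'
  have hmain := card_mul_card_sub_eq (univ.filter fun x => ∃ c ∈ C, (c : F) = Q x)
    (polarChar ψ Q hBadd)
    (fun x => by change ψ (polarForm Q x 0) = 1; rw [hpol0, AddChar.map_zero_eq_one])
    (fun x hx => by
      refine Eq.trans (sum_congr rfl fun b _ => ?_)
        (sum_polarForm_eq_zero hψ hBadd hBsmul hBnd hx)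
      change ψ (polarForm Q x b) = _
      rw [polarForm_comm])
    (fun x hx => by simpa [hQneg] using hx) hθ hg
  rw [hk, hV'] at hmain
  rw [← Int.cast_inj (α := ℂ)]
  refine mul_left_cancel₀ hN ?_
  rw [Int.cast_natCast, hmain]
  split_ifs <;> push_cast <;> ring

end QuadraticForm

/-- The canonical additive character of `F_{p^n}` as an `AddChar`. -/
def psiChar (p n : ℕ) [Fact p.Prime] : AddChar (GaloisField p n) ℂ :=
  (ZMod.stdAddChar (N := p)).compAddMonoidHom
    (Algebra.trace (ZMod p) (GaloisField p n)).toAddMonoidHom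

theorem psiChar_apply (p n : ℕ) [Fact p.Prime] (x : GaloisField p n) :
    psiChar p n x = ZMod.stdAddChar (Algebra.trace (ZMod p) (GaloisField p n) x) := rfl

theorem psi_eq_psiChar (p n : ℕ) [Fact p.Prime] (x : GaloisField p n) :
    psi p n x = psiChar p n x := by
  have h := ZMod.stdAddChar_coe (N := p) (Algebra.trace (ZMod p) (GaloisField p n) x).val
  rw [Int.cast_natCast, ZMod.natCast_zmod_val, Int.cast_natCast] at h
  rw [psiChar_apply, h, psi]

theorem psiChar_isPrimitive (p n : ℕ) [Fact p.Prime] : (psiChar p n).IsPrimitive := by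
  refine AddChar.IsPrimitive.of_ne_one fun h => ?_
  obtain ⟨x, hx⟩ := Algebra.trace_surjective (ZMod p) (GaloisField p n) 1
  have h1 := DFunLike.congr_fun h x
  rw [psiChar_apply, hx, AddChar.one_apply, ← AddChar.map_zero_eq_one (ZMod.stdAddChar (N := p)),
    ZMod.injective_stdAddChar.eq_iff] at h1
  exact one_ne_zero h1

theorem psiChar_pow (p n k : ℕ) [Fact p.Prime] (x : GaloisField p n) :
    psiChar p n (x ^ p ^ k) = psiChar p n x := by
  induction k with
  | zero => simp
  | succ k ih =>
    rw [pow_succ, pow_mul, ← ih, psiChar_apply, psiChar_apply]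
    have h := Algebra.trace_eq_of_algEquiv
      (FiniteField.frobeniusAlgEquivOfAlgebraic (ZMod p) (GaloisField p n)) (x ^ p ^ k)
    rw [FiniteField.coe_frobeniusAlgEquivOfAlgebraic, ZMod.card] at h
    rw [h]

theorem exists_pow_two_mul_sub_one_eq (r γ : ℕ) :
    ∃ M, r ^ (2 * γ) - 1 = (r + 1) * ((r - 1) * M) := by
  obtain ⟨M, hM⟩ := Nat.sub_dvd_pow_sub_pow (r ^ 2) 1 γ
  refine ⟨M, ?_⟩
  rw [one_pow, ← pow_mul] at hM
  rw [hM, ← mul_assoc, ← Nat.sq_sub_sq, one_pow]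

/-- The powers `g ^ (i + e * j)` of a generator form a set stable under `d`-th powers if
`e ∣ d`. -/
theorem mul_pow_mem_image_pow {G : Type*} [CommGroup G] [DecidableEq G] {g : G} {e f d : ℕ}
    (i : ℕ)
    (hg : ∀ x : G, ∃ k : ℕ, g ^ k = x) (hf : 0 < f) (hgef : g ^ (e * f) = 1) (hd : e ∣ d)
    {c : G} (hc : c ∈ (range f).image fun j => g ^ (i + e * j)) (x : G) :
    c * x ^ d ∈ (range f).image fun j => g ^ (i + e * j) := by
  obtain ⟨j, hj, rfl⟩ := mem_image.1 hc
  obtain ⟨k, rfl⟩ := hg x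
  obtain ⟨t, rfl⟩ := hd
  refine mem_image.2 ⟨(j + k * t) % f, mem_range.2 (Nat.mod_lt _ hf), ?_⟩
  have h : i + e * j + k * (e * t) =
      i + e * ((j + k * t) % f) + e * f * ((j + k * t) / f) := by
    calc _ = i + e * (j + k * t) := by ring
      _ = i + e * ((j + k * t) % f + f * ((j + k * t) / f)) := by rw [Nat.mod_add_div]
      _ = _ := by ring
  rw [← pow_mul, ← pow_add, h, pow_add _ (i + _), pow_mul _ (e * f), hgef, one_pow, mul_one]

/-- **Theorem 1.2 (Theorem PU).**  Let `p` be a prime, `e ≥ 2`, `q = p^{2jγ}` where `γ ≥ 1`,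
`e ∣ p^j + 1` and `j` is the smallest such positive integer.  Let `C_i`, `0 ≤ i ≤ e−1`, be the
cyclotomic classes of `F_q` of order `e`, `n = 2m`, and `Q : V = F_q^n → F_q` a nonsingular
quadratic form of type `ε` (i.e. `∑_{x∈V} ψ₁(αQ(x)) = ε q^m` for every `α ≠ 0`).  Then each set
`D_{C_i} = {x ∈ V : Q(x) ∈ C_i}` is a PDS in `(V,+)` with parameters
`(N², (N−ε)R, εN + R² − 3εR, R² − εR)`, where `N = q^m` and `R = f q^{m−1}`, `f = (q−1)/e`. -/
theorem affine_polar_uniform_cyclotomy_PDS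
    (p : ℕ) [Fact p.Prime] (e : ℕ) (he : 2 ≤ e)
    (j : ℕ) (hj : 0 < j) (hje : e ∣ p ^ j + 1)
    (hjmin : ∀ j' : ℕ, 0 < j' → e ∣ p ^ j' + 1 → j ≤ j')
    (γ : ℕ) (hγ : 1 ≤ γ) (m : ℕ) (hm : 1 ≤ m)
    (g : GaloisField p (2 * j * γ))
    (hg : ∀ x : GaloisField p (2 * j * γ), x ≠ 0 → ∃ k : ℕ, g ^ k = x)
    (Q : (Fin (2 * m) → GaloisField p (2 * j * γ)) → GaloisField p (2 * j * γ))
    (hQ : ∀ (a : GaloisField p (2 * j * γ)) x, Q (a • x) = a ^ 2 * Q x)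
    (hBadd : ∀ x y z, polarForm Q (x + y) z = polarForm Q x z + polarForm Q y z)
    (hBsmul : ∀ (a : GaloisField p (2 * j * γ)) x y,
      polarForm Q (a • x) y = a * polarForm Q x y)
    (hBnd : ∀ x, (∀ y, polarForm Q x y = 0) → x = 0)
    (ε : ℤ) (hε : ε = 1 ∨ ε = -1)
    (hsum : ∀ α : GaloisField p (2 * j * γ), α ≠ 0 →
      ∑ x : Fin (2 * m) → GaloisField p (2 * j * γ), psi p (2 * j * γ) (α * Q x)
        = (ε : ℂ) * ((p : ℂ) ^ (2 * j * γ)) ^ m) :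
    ∀ i < e,
      IsPDS
        (Finset.univ.filter fun x =>
          Q x ∈ cycClass p (2 * j * γ) g e ((p ^ (2 * j * γ) - 1) / e) i)
        ((((p : ℤ) ^ (2 * j * γ)) ^ m) ^ 2)
        ((((p : ℤ) ^ (2 * j * γ)) ^ m - ε) *
          (((p ^ (2 * j * γ) - 1) / e : ℕ) * ((p : ℤ) ^ (2 * j * γ)) ^ (m - 1)))
        (ε * ((p : ℤ) ^ (2 * j * γ)) ^ m
          + (((p ^ (2 * j * γ) - 1) / e : ℕ) * ((p : ℤ) ^ (2 * j * γ)) ^ (m - 1)) ^ 2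
          - 3 * ε * (((p ^ (2 * j * γ) - 1) / e : ℕ) * ((p : ℤ) ^ (2 * j * γ)) ^ (m - 1)))
        ((((p ^ (2 * j * γ) - 1) / e : ℕ) * ((p : ℤ) ^ (2 * j * γ)) ^ (m - 1)) ^ 2
          - ε * (((p ^ (2 * j * γ) - 1) / e : ℕ) * ((p : ℤ) ^ (2 * j * γ)) ^ (m - 1))) := by
  intro i hi
  have hr : 2 ≤ p ^ j := (Fact.out : p.Prime).two_le.trans (Nat.le_self_pow hj.ne' p)
  obtain ⟨M, hM⟩ := exists_pow_two_mul_sub_one_eq (p ^ j) γ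
  rw [← pow_mul, show j * (2 * γ) = 2 * j * γ by ring] at hM
  have hcard : Fintype.card (GaloisField p (2 * j * γ)) = p ^ (2 * j * γ) := by
    rw [← Nat.card_eq_fintype_card, GaloisField.card p _ (by positivity)]
  have hunits : Nat.card (GaloisField p (2 * j * γ))ˣ = p ^ (2 * j * γ) - 1 := by
    rw [Nat.card_eq_fintype_card, Fintype.card_units, hcard]
  obtain ⟨f, hf⟩ : e ∣ p ^ (2 * j * γ) - 1 := hje.trans ⟨_, hM⟩
  have hf0 : 0 < f := by
    have h : 0 < e * f := by rw [← hf, ← hunits]; exact Nat.card_pos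
    exact Nat.pos_of_mul_pos_left h
  have hfe : (p ^ (2 * j * γ) - 1) / e = f := by
    rw [hf, Nat.mul_div_cancel_left _ (by omega)]
  rw [hfe]
  have hg0 : g ≠ 0 := by
    rintro rfl
    have : Nontrivial (GaloisField p (2 * j * γ))ˣ := by
      rw [← Finite.one_lt_card_iff_nontrivial, hunits, hf]
      nlinarith
    obtain ⟨u, hu⟩ := exists_ne (1 : (GaloisField p (2 * j * γ))ˣ)
    obtain ⟨k, hk⟩ := hg u u.ne_zero
    rcases Nat.eq_zero_or_pos k with rfl | hk0
    · exact hu (Units.ext (by simpa using hk.symm))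
    · exact u.ne_zero (by rw [← hk, zero_pow hk0.ne'])
  obtain ⟨g, rfl⟩ : ∃ u : (GaloisField p (2 * j * γ))ˣ, (u : GaloisField p (2 * j * γ)) = g :=
    ⟨Units.mk0 g hg0, rfl⟩
  have hgen : ∀ x : (GaloisField p (2 * j * γ))ˣ, ∃ k : ℕ, g ^ k = x := fun x => by
    obtain ⟨k, hk⟩ := hg x x.ne_zero
    exact ⟨k, Units.ext (by simpa using hk)⟩
  have hord : orderOf g = e * f := by
    rw [← hf, ← hunits]
    exact orderOf_eq_card_of_forall_mem_zpowers fun x => by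
      obtain ⟨k, rfl⟩ := hgen x
      exact Subgroup.npow_mem_zpowers g k
  set C := (range f).image fun k => g ^ (i + e * k) with hC
  have hCcard : #C = f := by
    rw [hC, card_image_of_injOn, card_range]
    intro a ha b hb hab
    have hlt : ∀ a ∈ (range f : Set ℕ), i + e * a ∈ Set.Iio (orderOf g) := fun a ha => by
      have : a + 1 ≤ f := by simpa using ha
      rw [Set.mem_Iio, hord]
      nlinarith
    have h := pow_injOn_Iio_orderOf (hlt a ha) (hlt b hb) hab
    exact Nat.eq_of_mul_eq_mul_left (by omega) (Nat.add_left_cancel h)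
  have hD : (univ.filter fun x => Q x ∈ cycClass p (2 * j * γ) g e f i) =
      univ.filter fun x => ∃ c ∈ C, (c : GaloisField p (2 * j * γ)) = Q x := by
    ext x
    simp [cycClass, hC]
  have hCmul : ∀ c ∈ C, ∀ x, c * x ^ (p ^ j + 1) ∈ C := fun c hc x =>
    mul_pow_mem_image_pow i hgen hf0 (hord ▸ pow_orderOf_eq_one g) hje hc x
  rw [hD]
  refine isPDS_quadraticForm (psiChar_isPrimitive p _) (fun x y => add_pow_char_pow x y p j) hr
    (psiChar_pow p _ j) (hunits.trans hM) hQ hBadd hBsmul hBnd ?_ ?_ C hCmul ?_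
  · intro t ht
    have h := hsum t ht
    simp only [psi_eq_psiChar] at h
    rw [h]
    push_cast
    rfl
  · rw [Fintype.card_fun, hcard, Fintype.card_fin]
    push_cast
    ring
  · rw [hcard, hCcard]
    obtain ⟨n, rfl⟩ : ∃ n, m = n + 1 := ⟨m - 1, by omega⟩
    simp only [Nat.add_sub_cancel]
    push_cast
    ring
end
end

section
/- Let G be a finite abelian group of order v, written additively, and let D ⊆ G satisfy −D = D and 0 ∉ D. Let k, λ, μ be positive integers with |D| = k and k² = μv + (λ−μ)k + (k−μ). Then D is a (v,k,λ,μ) partial difference set in G if and only if for every nontrivial complex character χ of G, the character sum χ(D) = ∑_{d∈D} χ(d) equals ((λ−μ) + √((λ−μ)² + 4(k−μ)))/2 or ((λ−μ) − √((λ−μ)² + 4(k−μ)))/2. -/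
open Finset

noncomputable section
open scoped Classical

/-- A function on a finite abelian group vanishes iff all its character sums do. -/
theorem eq_zero_iff_forall_sum_mul_addChar_eq_zero {G : Type*} [AddCommGroup G] [Fintype G]
    (f : G → ℂ) : (∀ g, f g = 0) ↔ ∀ χ : AddChar G ℂ, ∑ g, f g * χ g = 0 := by
  refine ⟨fun h χ => by simp [h], fun h a => ?_⟩
  have key : ∑ χ : AddChar G ℂ, (∑ g, f g * χ g) * χ (-a) = f a * Fintype.card G := by
    simp_rw [Finset.sum_mul]
    rw [Finset.sum_comm]
    have inner (g : G) : ∑ χ : AddChar G ℂ, f g * χ g * χ (-a)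
        = f g * (if g = a then (Fintype.card G : ℂ) else 0) := by
      simp_rw [mul_assoc, ← AddChar.map_add_eq_mul, ← Finset.mul_sum]
      rw [AddChar.sum_apply_eq_ite]
      simp only [← sub_eq_add_neg, sub_eq_zero]
    simp [inner]
  simp only [h, zero_mul, Finset.sum_const_zero] at key
  have hcard : (Fintype.card G : ℂ) ≠ 0 := Nat.cast_ne_zero.mpr Fintype.card_ne_zero
  exact (mul_eq_zero.mp key.symm).resolve_right hcard

/-- The character transform of the difference count of a symmetric set is the square of its
character sum. -/
theorem sum_card_sub_eq_mul_addChar {G : Type*} [AddCommGroup G] [Fintype G]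
    (D : Finset G) (hsym : ∀ d ∈ D, -d ∈ D) (χ : AddChar G ℂ) :
    ∑ g, (((D ×ˢ D).filter fun xy => xy.1 - xy.2 = g).card : ℂ) * χ g = (∑ d ∈ D, χ d) ^ 2 := by
  have hneg : ∑ d ∈ D, χ (-d) = ∑ d ∈ D, χ d :=
    Finset.sum_bij' (fun d _ => -d) (fun d _ => -d) hsym hsym (by simp) (by simp) (by simp)
  calc _ = ∑ g, ∑ xy ∈ (D ×ˢ D).filter (fun xy => xy.1 - xy.2 = g), χ (xy.1 - xy.2) := by
        refine Finset.sum_congr rfl fun g _ => ?_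
        rw [Finset.sum_congr rfl fun xy hxy => by rw [(Finset.mem_filter.mp hxy).2],
          Finset.sum_const, nsmul_eq_mul]
    _ = ∑ xy ∈ D ×ˢ D, χ (xy.1 - xy.2) := Finset.sum_fiberwise _ _ _
    _ = (∑ d ∈ D, χ d) * ∑ d ∈ D, χ (-d) := by
        rw [Finset.sum_mul_sum, Finset.sum_product]
        simp_rw [sub_eq_add_neg, AddChar.map_add_eq_mul]
    _ = _ := by rw [hneg, sq]

/-- The number of representations of `0` as a difference of elements of `D` is `|D|`. -/
theorem card_filter_sub_eq_zero {G : Type*} [AddCommGroup G] (D : Finset G) :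
    ((D ×ˢ D).filter fun xy => xy.1 - xy.2 = 0).card = D.card := by
  simp_rw [sub_eq_zero]
  rw [← Finset.diag_card D]
  congr 1
  grind

/-- The parameters of a symmetric set avoiding `0` have nonnegative discriminant. -/
theorem pds_discriminant_nonneg {v k lam mu : ℤ} (hkv : k + 1 ≤ v) (hk : 0 < k) (hmu : 0 < mu)
    (hparam : k ^ 2 = mu * v + (lam - mu) * k + (k - mu)) :
    0 ≤ (lam - mu) ^ 2 + 4 * (k - mu) := by
  have h1 : k * (lam + 1) ≤ k * k := by nlinarith
  have h2 : lam + 1 ≤ k := le_of_mul_le_mul_left h1 hk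
  nlinarith [sq_nonneg (lam - mu + 2)]

/-- **Lemma 2.1 (character-sum criterion for PDS).**  Let `G` be an abelian group of order `v`,
`D ⊆ G` with `−D = D` and `0 ∉ D`, and let `k, λ, μ` be positive integers with `|D| = k` and
`k² = μv + (λ−μ)k + (k−μ)`.  Then `D` is a `(v,k,λ,μ)` PDS in `G` if and only if for every
nontrivial complex character `χ` of `G`,
`χ(D) = ((λ−μ) ± √((λ−μ)² + 4(k−μ)))/2`. -/
theorem pds_iff_character_sums {G : Type*} [AddCommGroup G] [Fintype G]
    (v k lam mu : ℤ) (hv : (Fintype.card G : ℤ) = v)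
    (D : Finset G) (hk : (D.card : ℤ) = k)
    (hsym : ∀ d ∈ D, -d ∈ D) (h0 : (0 : G) ∉ D)
    (hkpos : 0 < k) (hlampos : 0 < lam) (hmupos : 0 < mu)
    (hparam : k ^ 2 = mu * v + (lam - mu) * k + (k - mu)) :
    IsPDS D v k lam mu ↔
      ∀ χ : AddChar G ℂ, χ ≠ 1 →
        (∑ d ∈ D, χ d
            = (((lam : ℂ) - (mu : ℂ))
                + (Real.sqrt ((((lam - mu) ^ 2 + 4 * (k - mu) : ℤ)) : ℝ) : ℂ)) / 2 ∨
          ∑ d ∈ D, χ d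
            = (((lam : ℂ) - (mu : ℂ))
                - (Real.sqrt ((((lam - mu) ^ 2 + 4 * (k - mu) : ℤ)) : ℝ) : ℂ)) / 2) := by
  set S : AddChar G ℂ → ℂ := fun χ => ∑ d ∈ D, χ d with hS
  have hkv : k + 1 ≤ v := by
    have := Finset.card_lt_card (Finset.ssubset_univ_iff.mpr
      (fun h : D = Finset.univ => h0 (h ▸ Finset.mem_univ 0)))
    rw [Finset.card_univ] at this
    omega
  have hdisc := pds_discriminant_nonneg hkv hkpos hmupos hparam
  let N : G → ℂ := fun g => (((D ×ˢ D).filter fun xy => xy.1 - xy.2 = g).card : ℂ)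
  let f : G → ℂ := fun g =>
    N g - ((lam - mu) * (if g ∈ D then 1 else 0) + (k - mu) * (if g = 0 then 1 else 0) + mu)
  have hpds : IsPDS D v k lam mu ↔ ∀ g, f g = 0 := by
    have hpt (g : G) : f g = 0 ↔ (g ≠ 0 →
        ((((D ×ˢ D).filter fun xy => xy.1 - xy.2 = g).card : ℤ) =
          if g ∈ D then lam else mu)) := by
      by_cases hg : g = 0
      · subst hg
        have hkC : (D.card : ℂ) = k := by exact_mod_cast hk
        simp only [f, N, card_filter_sub_eq_zero, h0, hkC]
        simp
      · simp only [f, N, hg, sub_eq_zero, ne_eq, not_false_eq_true, forall_const]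
        rw [← Int.cast_inj (α := ℂ)]
        by_cases hD : g ∈ D <;> simp [hD]
    simp only [IsPDS, hv, hk, true_and, hpt]
  have hhat (χ : AddChar G ℂ) : ∑ g, f g * χ g =
      S χ ^ 2 - ((lam - mu) * S χ + (k - mu) + mu * ∑ g, χ g) := by
    simp only [f, N, sub_mul _ _ (χ _), add_mul, Finset.sum_sub_distrib, Finset.sum_add_distrib,
      sum_card_sub_eq_mul_addChar D hsym χ, mul_assoc, ← Finset.mul_sum, hS]
    simp
  have htriv : ∑ g, f g * (1 : AddChar G ℂ) g = 0 := by
    have hkC : (D.card : ℂ) = k := by exact_mod_cast hk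
    have hvC : (Fintype.card G : ℂ) = v := by exact_mod_cast hv
    have hp : (k : ℂ) ^ 2 = mu * v + (lam - mu) * k + (k - mu) := by exact_mod_cast hparam
    rw [hhat]
    simp only [hS, AddChar.one_apply, Finset.sum_const, nsmul_eq_mul, mul_one, Finset.card_univ,
      hkC, hvC]
    linear_combination hp
  rw [hpds, eq_zero_iff_forall_sum_mul_addChar_eq_zero]
  have hroot (χ : AddChar G ℂ) (hχ : χ ≠ 1) : ∑ g, f g * χ g = 0 ↔
      (S χ = (((lam : ℂ) - (mu : ℂ))
          + (Real.sqrt ((((lam - mu) ^ 2 + 4 * (k - mu) : ℤ)) : ℝ) : ℂ)) / 2 ∨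
        S χ = (((lam : ℂ) - (mu : ℂ))
          - (Real.sqrt ((((lam - mu) ^ 2 + 4 * (k - mu) : ℤ)) : ℝ) : ℂ)) / 2) := by
    have hsq : (Real.sqrt ((((lam - mu) ^ 2 + 4 * (k - mu) : ℤ)) : ℝ) : ℂ) ^ 2
        = ((lam : ℂ) - mu) ^ 2 + 4 * (k - mu) := by
      rw [← Complex.ofReal_pow, Real.sq_sqrt (by exact_mod_cast hdisc)]
      push_cast
      ring
    have hsum : ∑ g, χ g = 0 := AddChar.sum_eq_zero_of_ne_one hχ
    rw [hhat, hsum]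
    generalize (Real.sqrt ((((lam - mu) ^ 2 + 4 * (k - mu) : ℤ)) : ℝ) : ℂ) = r at hsq ⊢
    rw [← sub_eq_zero (a := S χ), ← sub_eq_zero (a := S χ), ← mul_eq_zero]
    refine Eq.congr_left ?_
    linear_combination (1 / 4 : ℂ) * hsq
  refine ⟨fun h χ hχ => (hroot χ hχ).mp (h χ), fun h χ => ?_⟩
  by_cases hχ : χ = 1
  · exact hχ ▸ htriv
  · exact (hroot χ hχ).mpr (h χ hχ)
end
end

section
/- Let p be a prime, e ≥ 2 an integer, j the smallest positive integer such that e divides p^j + 1, and q = p^{2jγ} with γ ≥ 1. If γ, p, and (p^j+1)/e are all odd (so that e is even), then the cyclotomic periods of order e of F_q satisfy η_{e/2} = √q − (√q+1)/e and η_i = −(1+√q)/e for all i ≠ e/2, where √q = p^{jγ}. -/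
open Finset

noncomputable section
open scoped Classical

/-- The absolute trace is invariant under iterates of the Frobenius. -/
lemma trace_pow_char_pow {p : ℕ} [Fact p.Prime] {F : Type*} [Field F] [Finite F]
    [Algebra (ZMod p) F] (N : ℕ) (x : F) :
    Algebra.trace (ZMod p) F (x ^ p ^ N) = Algebra.trace (ZMod p) F x := by
  induction N with
  | zero => simp
  | succ N ih =>
    rw [pow_succ, pow_mul, ← ih]
    have h := Algebra.trace_eq_of_algEquiv
      (FiniteField.frobeniusAlgEquivOfAlgebraic (ZMod p) F) (x ^ p ^ N)
    simpa [ZMod.card] using h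

/-- In a field of order `p ^ (2 * N)`, the element `x` is trace-orthogonal to the subfield of order
`p ^ N` exactly when its relative trace `x + x ^ p ^ N` vanishes. -/
lemma trace_mul_eq_zero_iff {p : ℕ} [Fact p.Prime] (hp : Odd p) {F : Type*} [Field F] [Finite F]
    [Algebra (ZMod p) F] {N : ℕ} (hF : ∀ y : F, y ^ p ^ (2 * N) = y) (x : F) :
    (∀ c : F, c ^ p ^ N = c → Algebra.trace (ZMod p) F (x * c) = 0) ↔ x ^ p ^ N = -x := by
  have : CharP F p := charP_of_injective_algebraMap (algebraMap (ZMod p) F).injective p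
  have hF' : ∀ y : F, (y ^ p ^ N) ^ p ^ N = y := fun y => by
    rw [← pow_mul, ← pow_add, ← two_mul, hF]
  constructor
  · intro h
    rw [← add_eq_zero_iff_eq_neg]
    apply traceForm_nondegenerate (ZMod p) F |>.1
    intro y
    rw [Algebra.traceForm_apply]
    have h1 := h (y + y ^ p ^ N) (by rw [add_pow_char_pow, hF', add_comm])
    have h2 := trace_pow_char_pow (p := p) N (x * y ^ p ^ N)
    rw [mul_pow, hF'] at h2
    rw [mul_add, map_add, ← h2] at h1
    rw [add_mul, map_add, add_comm, h1]
  · intro h c hc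
    have h2 := trace_pow_char_pow (p := p) N (x * c)
    rw [mul_pow, hc, h, neg_mul, map_neg] at h2
    have hp2 : p ≠ 2 := by rintro rfl; exact absurd hp (by decide)
    have : Fact (2 < p) := ⟨lt_of_le_of_ne (Fact.out : p.Prime).two_le hp2.symm⟩
    exact ZMod.neg_eq_self_iff _ |>.1 h2 |>.resolve_right fun h => by
      obtain ⟨k, rfl⟩ := hp
      omega

lemma psi_eq_stdAddChar (p n : ℕ) [Fact p.Prime] (x : GaloisField p n) :
    psi p n x = ZMod.stdAddChar (Algebra.trace (ZMod p) (GaloisField p n) x) := by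
  have h := ZMod.stdAddChar_coe (N := p) ((Algebra.trace (ZMod p) (GaloisField p n) x).val : ℤ)
  rw [Int.cast_natCast, ZMod.natCast_zmod_val] at h
  rw [h, psi, Int.cast_natCast]

lemma psi_add (p n : ℕ) [Fact p.Prime] (x y : GaloisField p n) :
    psi p n (x + y) = psi p n x * psi p n y := by
  simp only [psi_eq_stdAddChar, map_add, AddChar.map_add_eq_mul]

lemma psi_eq_one_iff (p n : ℕ) [Fact p.Prime] (x : GaloisField p n) :
    psi p n x = 1 ↔ Algebra.trace (ZMod p) (GaloisField p n) x = 0 := by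
  rw [psi_eq_stdAddChar, ← AddChar.map_zero_eq_one (ZMod.stdAddChar (N := p)),
    ZMod.injective_stdAddChar.eq_iff]

lemma galoisField_pow_card {p n : ℕ} [Fact p.Prime] (hn : n ≠ 0) (x : GaloisField p n) :
    x ^ p ^ n = x := by
  rw [← GaloisField.card p n hn, Nat.card_eq_fintype_card, FiniteField.pow_card]

/-- The sum of `c ↦ ψ₁(x c)` over the subfield of order `p ^ N` of `F_{p^{2N}}`. -/
lemma sum_psi_mul_subfield {p n N : ℕ} [Fact p.Prime] (hp : Odd p) (hn : n = 2 * N) (hN : N ≠ 0)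
    (x : GaloisField p n) :
    ∑ c : GaloisField p n with c ^ p ^ N = c, psi p n (x * c) =
      if x ^ p ^ N = -x then (#{c : GaloisField p n | c ^ p ^ N = c} : ℂ) else 0 := by
  have hF : ∀ y : GaloisField p n, y ^ p ^ (2 * N) = y := by
    rw [← hn]; exact galoisField_pow_card (by omega)
  have key := trace_mul_eq_zero_iff hp hF x
  split_ifs with h
  · rw [sum_congr rfl fun c hc => (psi_eq_one_iff p n _).2 (key.2 h c (mem_filter.1 hc).2)]
    simp
  · rw [← key] at h
    push Not at h
    obtain ⟨d, hd, hd0⟩ := h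
    rw [Ne, ← psi_eq_one_iff] at hd0
    have hshift : ∑ c : GaloisField p n with c ^ p ^ N = c, psi p n (x * c) =
        psi p n (x * d) * ∑ c : GaloisField p n with c ^ p ^ N = c, psi p n (x * c) := by
      rw [mul_sum]
      refine sum_nbij' (fun c => c - d) (fun c => c + d) ?_ ?_ ?_ ?_ ?_
      · intro c hc
        simp only [mem_filter, mem_univ, true_and] at hc ⊢
        rw [sub_pow_char_pow, hc, hd]
      · intro c hc
        simp only [mem_filter, mem_univ, true_and] at hc ⊢
        rw [add_pow_char_pow, hc, hd]
      · simp
      · simp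
      · intro c _
        rw [← psi_add]
        ring_nf
    by_contra h0
    exact hd0 (mul_right_cancel₀ h0 (by rw [one_mul, ← hshift]))

lemma orderOf_eq_card_sub_one {F : Type*} [Field F] [Finite F] {g : F}
    (hg : ∀ x : F, x ≠ 0 → ∃ k : ℕ, g ^ k = x) (hcard : 2 < Nat.card F) :
    g ≠ 0 ∧ orderOf g = Nat.card F - 1 := by
  have := Fintype.ofFinite F
  have h0 : g ≠ 0 := by
    rintro rfl
    obtain ⟨x, hx⟩ : ∃ x : F, x ∉ ({0, 1} : Finset F) := by
      by_contra! h
      have h1 := card_le_card (fun x _ => h x : (univ : Finset F) ⊆ {0, 1})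
      rw [card_univ, ← Nat.card_eq_fintype_card] at h1
      have h2 := card_le_two (a := (0 : F)) (b := 1)
      omega
    simp only [mem_insert, mem_singleton, not_or] at hx
    obtain ⟨k, hk⟩ := hg x hx.1
    rcases Nat.eq_zero_or_pos k with rfl | hk0
    · exact hx.2 (by simpa using hk.symm)
    · exact hx.1 (by rw [← hk, zero_pow hk0.ne'])
  refine ⟨h0, ?_⟩
  rw [← Units.val_mk0 h0, orderOf_units, ← Nat.card_units]
  refine orderOf_eq_card_of_forall_mem_powers fun y => ?_
  obtain ⟨k, hk⟩ := hg y y.ne_zero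
  exact ⟨k, Units.ext (by simpa using hk)⟩

/-- The subfield of order `r` of a field of order `r ^ 2` consists of zero and the powers of
`g ^ (r + 1)`. -/
lemma filter_pow_eq_self {F : Type*} [Field F] [Fintype F] {g : F}
    (hg : ∀ x : F, x ≠ 0 → ∃ k : ℕ, g ^ k = x) {r : ℕ} (hr : 2 ≤ r)
    (hord : orderOf g = (r - 1) * (r + 1)) :
    ({c : F | c ^ r = c} : Finset F) =
      insert 0 ((range (r - 1)).image fun s => g ^ ((r + 1) * s)) := by
  obtain ⟨r, rfl⟩ : ∃ s, r = s + 1 := ⟨r - 1, by omega⟩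
  simp only [Nat.add_sub_cancel] at *
  ext c
  simp only [mem_filter, mem_univ, true_and, mem_insert, mem_image, mem_range]
  constructor
  · intro hc
    refine or_iff_not_imp_left.2 fun hc0 => ?_
    obtain ⟨k, rfl⟩ := hg c hc0
    have h1 : g ^ (k * r) = 1 := by
      rw [pow_succ, ← pow_mul] at hc
      exact (mul_eq_right₀ hc0).1 hc
    rw [← orderOf_dvd_iff_pow_eq_one, hord, mul_comm] at h1
    obtain ⟨l, rfl⟩ := Nat.dvd_of_mul_dvd_mul_right (by omega) h1
    refine ⟨l % r, Nat.mod_lt _ (by omega), ?_⟩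
    conv_rhs => rw [← Nat.mod_add_div l r, mul_add, pow_add, ← mul_assoc, mul_comm (r + 1 + 1) r,
      pow_mul g (r * _), ← hord, pow_orderOf_eq_one, one_pow, mul_one]
  · rintro (rfl | ⟨s, -, rfl⟩)
    · simp
    · have h : (r + 1 + 1) * s * (r + 1) = (r * (r + 1 + 1)) * s + (r + 1 + 1) * s := by ring
      rw [← pow_mul, h, pow_add, pow_mul g (r * _), ← hord, pow_orderOf_eq_one, one_pow, one_mul]

/-- Conjugation over the subfield of order `r` negates `g ^ k`, for `k ≤ r`, if and only if
`2 * k = r + 1`. -/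
lemma pow_pow_eq_neg_iff {F : Type*} [Field F] {g : F} (h0 : g ≠ 0) (h2 : (2 : F) ≠ 0) {r : ℕ}
    (hr : 2 ≤ r) (hord : orderOf g = (r - 1) * (r + 1)) {k : ℕ} (hk : k < r + 1) :
    (g ^ k) ^ r = -g ^ k ↔ 2 * k = r + 1 := by
  obtain ⟨r, rfl⟩ : ∃ s, r = s + 1 := ⟨r - 1, by omega⟩
  simp only [Nat.add_sub_cancel] at *
  have hne : (1 : F) ≠ -1 := fun h => h2 (by linear_combination h)
  have h1 : (g ^ k) ^ (r + 1) = -g ^ k ↔ g ^ (k * r) = -1 := by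
    rw [pow_succ, ← pow_mul, ← neg_one_mul (g ^ k)]
    exact mul_left_inj' (pow_ne_zero k h0)
  rw [h1]
  constructor
  · intro h
    have h3 : g ^ (2 * k * r) = 1 := by
      rw [mul_assoc, mul_comm 2, pow_mul, h]; norm_num
    rw [← orderOf_dvd_iff_pow_eq_one, hord, mul_comm r] at h3
    obtain ⟨l, hl⟩ := Nat.dvd_of_mul_dvd_mul_right (by omega) h3
    have hl2 : l < 2 := by
      by_contra! hl2
      have := Nat.mul_le_mul_left (r + 1 + 1) hl2
      omega
    interval_cases l
    · obtain rfl : k = 0 := by omega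
      simp [hne] at h
    · omega
  · intro h
    have h3 : g ^ (k * r) * g ^ (k * r) = 1 := by
      rw [← pow_add, ← orderOf_dvd_iff_pow_eq_one, hord, ← h]
      exact ⟨1, by ring⟩
    refine (mul_self_eq_one_iff.1 h3).resolve_left fun h4 => ?_
    rw [← orderOf_dvd_iff_pow_eq_one, hord, mul_comm r] at h4
    have := Nat.le_of_dvd (by omega) (Nat.dvd_of_mul_dvd_mul_right (by omega) h4)
    omega

/-- If `g` has order `a * b`, the elements `g ^ (i + b * s)` with `s < a` are distinct. -/
lemma injOn_pow_mul {F : Type*} [Field F] {g : F} (h0 : g ≠ 0) {a b : ℕ} (hb : b ≠ 0)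
    (hord : orderOf g = a * b) (i : ℕ) :
    Set.InjOn (fun s => g ^ (i + b * s)) (range a : Set ℕ) := by
  intro s hs t ht hst
  simp only [coe_range, Set.mem_Iio] at hs ht
  simp only [pow_add] at hst
  have h := mul_left_cancel₀ (pow_ne_zero i h0) hst
  have hlt : ∀ u < a, b * u < orderOf g := fun u hu => by
    rw [hord, mul_comm a]; exact Nat.mul_lt_mul_of_pos_left hu (by omega)
  exact Nat.eq_of_mul_eq_mul_left (by omega) (pow_injOn_Iio_orderOf (hlt s hs) (hlt t ht) h)

/-- The sum of `ψ₁` over a coset of the multiplicative group of the subfield of order `p ^ N`. -/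
lemma sum_psi_coset {p n N : ℕ} [Fact p.Prime] (hp : Odd p) (hn : n = 2 * N) (hN : N ≠ 0)
    {g : GaloisField p n} (h0 : g ≠ 0) (hg : ∀ x : GaloisField p n, x ≠ 0 → ∃ k : ℕ, g ^ k = x)
    (hord : orderOf g = (p ^ N - 1) * (p ^ N + 1)) (x : GaloisField p n) :
    ∑ s ∈ range (p ^ N - 1), psi p n (x * g ^ ((p ^ N + 1) * s)) =
      (if x ^ p ^ N = -x then (p : ℂ) ^ N else 0) - 1 := by
  have hr : 2 ≤ p ^ N := (Fact.out : p.Prime).two_le.trans (Nat.le_self_pow hN p)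
  have hK := filter_pow_eq_self hg hr hord
  have hinj := injOn_pow_mul h0 (Nat.succ_ne_zero _) hord 0
  simp only [zero_add] at hinj
  have hnot : (0 : GaloisField p n) ∉
      (range (p ^ N - 1)).image fun s => g ^ ((p ^ N + 1) * s) := by
    simp [h0]
  have hcard : #{c : GaloisField p n | c ^ p ^ N = c} = p ^ N := by
    rw [hK, card_insert_of_notMem hnot, card_image_of_injOn hinj, card_range]
    omega
  have hsum := sum_psi_mul_subfield hp hn hN x
  rw [hcard, hK, sum_insert hnot, sum_image hinj, mul_zero,
    (psi_eq_one_iff p n 0).2 (map_zero _)] at hsum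
  push_cast at hsum
  rw [← hsum]
  ring

/-- The period of index `i` is the sum over `t < m`, where `m = (p ^ N + 1) / e`, of the sums of
`ψ₁` over the multiplicative cosets `g ^ (i + e * t) * F_{p^N}ˣ`. -/
lemma sum_cycClass_eq {p n N : ℕ} [Fact p.Prime] {g : GaloisField p n} {e m i : ℕ}
    (hm : p ^ N + 1 = e * m) (he : e ≠ 0) (h0 : g ≠ 0)
    (hord : orderOf g = (p ^ N - 1) * (p ^ N + 1)) :
    ∑ z ∈ cycClass p n g e (m * (p ^ N - 1)) i, psi p n z =
      ∑ t ∈ range m, ∑ s ∈ range (p ^ N - 1),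
        psi p n (g ^ (i + e * t) * g ^ ((p ^ N + 1) * s)) := by
  have hm0 : 0 < m := Nat.pos_of_ne_zero fun h => by simp [h] at hm
  rw [cycClass, sum_image (injOn_pow_mul h0 he (by rw [hord, hm]; ring) i), ← sum_product']
  refine sum_nbij' (fun k => (k % m, k / m)) (fun ts => ts.1 + m * ts.2) ?_ ?_ ?_ ?_ ?_
  · intro k hk
    rw [mem_range] at hk
    simp only [mem_product, mem_range]
    exact ⟨Nat.mod_lt _ hm0, Nat.div_lt_of_lt_mul hk⟩
  · rintro ⟨t, s⟩ hts
    simp only [mem_product, mem_range] at hts ⊢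
    calc t + m * s < m * (s + 1) := by rw [mul_add]; omega
      _ ≤ m * (p ^ N - 1) := Nat.mul_le_mul_left _ hts.2
  · intro k _
    exact Nat.mod_add_div k m
  · rintro ⟨t, s⟩ hts
    simp only [mem_product, mem_range] at hts
    simp [Nat.add_mul_mod_self_left, Nat.mod_eq_of_lt hts.1, Nat.add_mul_div_left _ _ hm0,
      Nat.div_eq_of_lt hts.1]
  · intro k _
    rw [← pow_add, hm]
    conv_lhs => rw [← Nat.mod_add_div k m]
    ring_nf

/-- The cyclotomic periods of order `e` of `F_{p^{2N}}` when `(p ^ N + 1) / e` is an odd integer. -/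
lemma sum_psi_cycClass {p n N : ℕ} [Fact p.Prime] (hp : Odd p) (hn : n = 2 * N) (hN : N ≠ 0)
    {g : GaloisField p n} (hg : ∀ x : GaloisField p n, x ≠ 0 → ∃ k : ℕ, g ^ k = x)
    {e m i : ℕ} (hm : p ^ N + 1 = e * m) (hmodd : Odd m) (hi : i < e) :
    ∑ z ∈ cycClass p n g e ((p ^ n - 1) / e) i, psi p n z =
      (if i = e / 2 then (p : ℂ) ^ N else 0) - m := by
  have hr : 3 ≤ p ^ N := by
    have h2 := (Fact.out : p.Prime).two_le
    have h3 : p ≠ 2 := by rintro rfl; exact absurd hp (by decide)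
    exact (show 3 ≤ p by omega).trans (Nat.le_self_pow hN p)
  have hq : p ^ n = (p ^ N - 1) * (p ^ N + 1) + 1 := by
    obtain ⟨r, hr'⟩ : ∃ r, p ^ N = r + 1 := ⟨p ^ N - 1, by omega⟩
    rw [hn, mul_comm, pow_mul, hr', Nat.add_sub_cancel]
    ring
  have hcard := GaloisField.card p n (by omega)
  obtain ⟨h0, hord⟩ := orderOf_eq_card_sub_one hg (by
    rw [hcard, hq]
    have := Nat.mul_le_mul (show 2 ≤ p ^ N - 1 by omega) (show 4 ≤ p ^ N + 1 by omega)
    omega)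
  rw [hcard, hq, Nat.add_sub_cancel] at hord
  have hf : (p ^ n - 1) / e = m * (p ^ N - 1) := by
    rw [hq, Nat.add_sub_cancel, hm, mul_left_comm, Nat.mul_div_cancel_left _ (by omega), mul_comm]
  have h2 : (2 : GaloisField p n) ≠ 0 := by
    intro h
    have h3 := (CharP.cast_eq_zero_iff (GaloisField p n) p 2).1 (by exact_mod_cast h)
    have h4 := (Nat.prime_dvd_prime_iff_eq Fact.out Nat.prime_two).1 h3
    subst h4
    exact absurd hp (by decide)
  rw [hf, sum_cycClass_eq hm (by omega) h0 hord,
    sum_congr rfl fun t _ => sum_psi_coset hp hn hN h0 hg hord _, sum_sub_distrib]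
  simp only [sum_const, card_range, nsmul_eq_mul, mul_one, sub_left_inj]
  obtain ⟨d, rfl⟩ := hmodd
  have he : e % 2 = 0 := by
    have h5 : Even (e * (2 * d + 1)) := hm ▸ (hp.pow.add_odd odd_one)
    rcases Nat.even_mul.1 h5 with h | h
    · exact Nat.even_iff.1 h
    · exact absurd h (by simp)
  have hiff : ∀ t ∈ range (2 * d + 1), ((g ^ (i + e * t)) ^ p ^ N = -g ^ (i + e * t) ↔
      i = e / 2 ∧ t = d) := by
    intro t ht
    rw [mem_range] at ht
    have hle : e * (t + 1) ≤ e * (2 * d + 1) := Nat.mul_le_mul_left _ ht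
    rw [mul_add] at hle
    rw [pow_pow_eq_neg_iff h0 h2 (by omega) hord (by omega), hm]
    obtain ⟨a, rfl⟩ : ∃ a, e = 2 * a := ⟨e / 2, by omega⟩
    rw [Nat.mul_div_cancel_left _ two_pos]
    constructor
    · intro h
      have h6 : i + 2 * a * t = a + 2 * a * d := by linarith
      have ht : t = d := by
        rcases lt_trichotomy t d with h7 | h7 | h7
        · nlinarith
        · exact h7
        · nlinarith
      subst ht
      exact ⟨by omega, rfl⟩
    · rintro ⟨rfl, rfl⟩
      ring
  rw [sum_congr rfl fun t ht => if_congr (hiff t ht) rfl rfl]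
  by_cases hie : i = e / 2
  · simp [hie, show d < 2 * d + 1 by omega]
  · simp [hie]

/-- The quotient `(P ^ k + 1) / (P + 1)` is an odd integer when `P` and `k` are odd. -/
lemma exists_odd_pow_add_one_eq {P k : ℕ} (hP : Odd P) (hk : Odd k) :
    ∃ b, Odd b ∧ P ^ k + 1 = (P + 1) * b := by
  obtain ⟨a, rfl⟩ := hP
  obtain ⟨k, rfl⟩ := hk
  induction k with
  | zero => exact ⟨1, odd_one, by ring⟩
  | succ k ih =>
    obtain ⟨_, ⟨c, rfl⟩, h⟩ := ih
    refine ⟨_, ⟨c * (2 * a + 1) ^ 2 + 2 * a ^ 2 + a, rfl⟩, ?_⟩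
    have h' : (2 * a + 1) ^ (2 * (k + 1) + 1) + 1 + (2 * a + 1) ^ 2 =
        (2 * a + 1) ^ 2 * ((2 * a + 1) ^ (2 * k + 1) + 1) + 1 := by ring
    rw [h] at h'
    linarith

/-- **Theorem 2.2, Case A (uniform cyclotomy).**  Let `p` be a prime, `e ≥ 2`, `q = p^{2jγ}`
where `γ ≥ 1`, `e ∣ p^j + 1` and `j` is the smallest such positive integer.  If `γ`, `p`, and
`(p^j+1)/e` are all odd, then the cyclotomic periods of order `e` of `F_q` satisfy
`η_{e/2} = √q − (√q+1)/e` and `η_i = −(1+√q)/e` for all `i ≠ e/2`, where `√q = p^{jγ}`. -/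
theorem uniform_cyclotomy_case_A
    (p : ℕ) [Fact p.Prime] (e : ℕ) (he : 2 ≤ e)
    (j : ℕ) (hj : 0 < j) (hje : e ∣ p ^ j + 1)
    (hjmin : ∀ j' : ℕ, 0 < j' → e ∣ p ^ j' + 1 → j ≤ j')
    (γ : ℕ) (hγ : 1 ≤ γ)
    (hoddγ : Odd γ) (hoddp : Odd p) (hoddf : Odd ((p ^ j + 1) / e))
    (g : GaloisField p (2 * j * γ))
    (hg : ∀ x : GaloisField p (2 * j * γ), x ≠ 0 → ∃ k : ℕ, g ^ k = x) :
    (∑ z ∈ cycClass p (2 * j * γ) g e ((p ^ (2 * j * γ) - 1) / e) (e / 2),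
        psi p (2 * j * γ) z)
        = (p : ℂ) ^ (j * γ) - ((p : ℂ) ^ (j * γ) + 1) / e ∧
      ∀ i < e, i ≠ e / 2 →
        (∑ z ∈ cycClass p (2 * j * γ) g e ((p ^ (2 * j * γ) - 1) / e) i,
            psi p (2 * j * γ) z)
          = -(1 + (p : ℂ) ^ (j * γ)) / e := by
  obtain ⟨b, hbodd, hb⟩ := exists_odd_pow_add_one_eq (hoddp.pow (n := j)) hoddγ
  rw [← pow_mul] at hb
  have hm : p ^ (j * γ) + 1 = e * ((p ^ j + 1) / e * b) := by
    rw [← mul_assoc, Nat.mul_div_cancel' hje, hb]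
  have hmC : ((p : ℂ) ^ (j * γ) + 1) / e = ((p ^ j + 1) / e * b : ℕ) := by
    rw [div_eq_iff (by exact_mod_cast (by omega : e ≠ 0))]
    exact_mod_cast hm.trans (mul_comm _ _)
  have key := fun i (hi : i < e) => sum_psi_cycClass hoddp (mul_assoc 2 j γ)
    (Nat.mul_ne_zero hj.ne' (by omega)) hg hm (hoddf.mul hbodd) hi
  constructor
  · rw [key _ (by omega), if_pos rfl, hmC]
  · intro i hi hne
    rw [key i hi, if_neg hne, neg_div, add_comm 1, hmC, zero_sub]
end
end
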